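/- Let 0 < α < 1 and M₀ > 0. For every continuously differentiable, compactly supported function φ : ℝ² → ℝ, the following identity holds: √2·∫_0^∞ ∫_{−∞}^0 ∂_t φ(t, x) dx dt + (2 − 2/(α·M₀²))·∫_0^∞ ∫_{−∞}^0 ∂_x φ(t, x) dx dt − (2 − 2/(α·M₀²))·∫_0^∞ φ(t, 0) dt + √2·∫_{−∞}^0 φ(0, x) dx = 0. (This is the statement that the measures m = √2·I_Ω·L², n = 2·I_Ω·L², ℘ = −(2/(α·M₀²))·I_Ω·L² with boundary pressure weight w_p(t) = 2 − 2/(α·M₀²) satisfy the weak momentum equation of the limiting piston problem; when M₀ ≥ √(α^{−1}) the weight w_p is nonnegative, so the Radon measure solution is admissible.) -/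

import Mathlib

open MeasureTheory Set

lemma hasDerivAt_prodMk_left {φ : ℝ × ℝ → ℝ} (hφ : Differentiable ℝ φ) (t x : ℝ) :
    HasDerivAt (fun s => φ (s, x)) (fderiv ℝ φ (t, x) (1, 0)) t :=
  (hφ (t, x)).hasFDerivAt.comp_hasDerivAt t ((hasDerivAt_id t).prodMk (hasDerivAt_const t x))

lemma hasDerivAt_prodMk_right {φ : ℝ × ℝ → ℝ} (hφ : Differentiable ℝ φ) (t x : ℝ) :
    HasDerivAt (fun y => φ (t, y)) (fderiv ℝ φ (t, x) (0, 1)) x :=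
  (hφ (t, x)).hasFDerivAt.comp_hasDerivAt x ((hasDerivAt_const x t).prodMk (hasDerivAt_id x))

lemma hasCompactSupport_prodMk_left {φ : ℝ × ℝ → ℝ} (hφ : HasCompactSupport φ) (x : ℝ) :
    HasCompactSupport fun t => φ (t, x) :=
  hφ.comp_isClosedEmbedding
    (Isometry.of_dist_eq fun _ _ => by simp [Prod.dist_eq] : Isometry fun t : ℝ => (t, x)).isClosedEmbedding

lemma hasCompactSupport_prodMk_right {φ : ℝ × ℝ → ℝ} (hφ : HasCompactSupport φ) (t : ℝ) :
    HasCompactSupport fun x => φ (t, x) :=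
  hφ.comp_isClosedEmbedding
    (Isometry.of_dist_eq fun _ _ => by simp [Prod.dist_eq] : Isometry fun x : ℝ => (t, x)).isClosedEmbedding

lemma integral_Ioi_fderiv_left {φ : ℝ × ℝ → ℝ} (hφ : ContDiff ℝ 1 φ)
    (hφc : HasCompactSupport φ) (a x : ℝ) :
    ∫ t in Ioi a, fderiv ℝ φ (t, x) (1, 0) = -φ (a, x) := by
  simp_rw [← (hasDerivAt_prodMk_left (hφ.differentiable one_ne_zero) _ x).deriv]
  exact (hasCompactSupport_prodMk_left hφc x).integral_Ioi_deriv_eq (by fun_prop) a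

lemma integral_Iio_fderiv_right {φ : ℝ × ℝ → ℝ} (hφ : ContDiff ℝ 1 φ)
    (hφc : HasCompactSupport φ) (t b : ℝ) :
    ∫ x in Iio b, fderiv ℝ φ (t, x) (0, 1) = φ (t, b) := by
  simp_rw [← integral_Iic_eq_integral_Iio,
    ← (hasDerivAt_prodMk_right (hφ.differentiable one_ne_zero) t _).deriv]
  exact (hasCompactSupport_prodMk_right hφc t).integral_Iic_deriv_eq (by fun_prop) b

lemma integrable_fderiv_apply {φ : ℝ × ℝ → ℝ} (hφ : ContDiff ℝ 1 φ)
    (hφc : HasCompactSupport φ) (v : ℝ × ℝ) : Integrable fun z => fderiv ℝ φ z v :=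
  ((hφ.continuous_fderiv one_ne_zero).clm_apply continuous_const).integrable_of_hasCompactSupport
    (hφc.fderiv_apply (𝕜 := ℝ) v)


/-- The measures `m = √2·I_Ω·L²`, `n = 2·I_Ω·L²`, `℘ = -(2/(αM₀²))·I_Ω·L²`
with boundary pressure weight `w_p(t) = 2 - 2/(αM₀²)` satisfy the weak momentum
equation of the limiting piston problem. -/
theorem radon_measure_momentum_equation
    (α M₀ : ℝ) (hα0 : 0 < α) (hα1 : α < 1) (hM : 0 < M₀)
    (φ : ℝ × ℝ → ℝ) (hφ : ContDiff ℝ 1 φ) (hφc : HasCompactSupport φ) :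
    Real.sqrt 2 *
        (∫ t in Set.Ioi (0:ℝ), ∫ x in Set.Iio (0:ℝ), fderiv ℝ φ (t, x) (1, 0))
      + (2 - 2 / (α * M₀ ^ 2)) *
        (∫ t in Set.Ioi (0:ℝ), ∫ x in Set.Iio (0:ℝ), fderiv ℝ φ (t, x) (0, 1))
      - (2 - 2 / (α * M₀ ^ 2)) * (∫ t in Set.Ioi (0:ℝ), φ (t, 0))
      + Real.sqrt 2 * (∫ x in Set.Iio (0:ℝ), φ (0, x)) = 0 := by
  have hswap : ∫ t in Ioi (0:ℝ), ∫ x in Iio (0:ℝ), fderiv ℝ φ (t, x) (1, 0)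
      = -∫ x in Iio (0:ℝ), φ (0, x) := by
    rw [integral_integral_swap (f := fun t x => fderiv ℝ φ (t, x) (1, 0))]
    · simp_rw [integral_Ioi_fderiv_left hφ hφc, integral_neg]
    · rw [Measure.prod_restrict]
      exact (integrable_fderiv_apply hφ hφc (1, 0)).integrableOn
  simp_rw [hswap, integral_Iio_fderiv_right hφ hφc]
  ring
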